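/- Let F be a finite field and T a 3-tensor over F. Then AR(T) ≥ (1 − log_{|F|} 2) · GR(T). -/

import Mathlib

/-- A (possibly reducible) affine subvariety of `K^n`: the common zero set of a collection of
polynomials. -/
def IsSubvariety {K : Type*} [Field K] {n : ℕ} (W : Set (Fin n → K)) : Prop :=
  ∃ S : Set (MvPolynomial (Fin n) K), W = {x | ∀ p ∈ S, MvPolynomial.eval x p = 0}

/-- An irreducible subvariety: a nonempty subvariety that cannot be covered by two subvarieties
unless it is contained in one of them. -/
def IsIrreducibleSubvariety {K : Type*} [Field K] {n : ℕ} (W : Set (Fin n → K)) : Prop :=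
  IsSubvariety W ∧ W.Nonempty ∧ ∀ W₁ W₂ : Set (Fin n → K), IsSubvariety W₁ → IsSubvariety W₂ →
    W ⊆ W₁ ∪ W₂ → W ⊆ W₁ ∨ W ⊆ W₂

/-- The dimension of a variety `V`: the maximal length `k` of a strict chain
`C 0 ⊊ C 1 ⊊ ⋯ ⊊ C k` of irreducible subvarieties contained in `V`. -/
noncomputable def varDim {K : Type*} [Field K] {n : ℕ} (V : Set (Fin n → K)) : ℕ :=
  sSup {k | ∃ C : Fin (k + 1) → Set (Fin n → K),
    (∀ i, IsIrreducibleSubvariety (C i)) ∧ (∀ i, C i ⊆ V) ∧ StrictMono C}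

open scoped BigOperators

section

theorem linearIndependent_mk_comp_iff {K R ι : Type*} [Field K] [CommRing R] [Algebra K R]
    (J : Ideal R) (v : ι → R) :
    LinearIndependent K (fun i => Ideal.Quotient.mk J (v i)) ↔
      ∀ c : ι →₀ K, Finsupp.linearCombination K v c ∈ J → c = 0 := by
  have key : ∀ c : ι →₀ K, Finsupp.linearCombination K (fun i => Ideal.Quotient.mk J (v i)) c =
      Ideal.Quotient.mk J (Finsupp.linearCombination K v c) := fun c => by
    rw [← Ideal.Quotient.mkₐ_eq_mk K J]
    exact (Finsupp.apply_linearCombination K (Ideal.Quotient.mkₐ K J).toLinearMap v c).symm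
  simp only [linearIndependent_iff, key, Ideal.Quotient.eq_zero_iff_mem]

/-- If `v` is linearly independent modulo `J'`, `g ∈ J'` and `g` is a nonzerodivisor modulo
`J ≤ J'`, then the products `g ^ k * v i` are linearly independent modulo `J`. -/
theorem LinearIndependent.pow_mul_mk {K R ι : Type*} [Field K] [CommRing R] [Algebra K R]
    {J J' : Ideal R} {v : ι → R} {g : R} (hJ : J ≤ J') (hgJ' : g ∈ J')
    (hg : ∀ x, g * x ∈ J → x ∈ J)
    (hv : LinearIndependent K (fun i => Ideal.Quotient.mk J' (v i))) :
    LinearIndependent K (fun p : ℕ × ι => Ideal.Quotient.mk J (g ^ p.1 * v p.2)) := by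
  classical
  rw [linearIndependent_mk_comp_iff] at hv ⊢
  intro c hc
  have hpow : ∀ k x, g ^ k * x ∈ J → x ∈ J := fun k => by
    induction k with
    | zero => simp
    | succ k ih => exact fun x hx => ih x (hg _ (by rwa [pow_succ', mul_assoc] at hx))
  have hsum : Finsupp.linearCombination K (fun p : ℕ × ι => g ^ p.1 * v p.2) c =
      ∑ k ∈ c.curry.support, g ^ k * Finsupp.linearCombination K v (c.curry k) := by
    rw [Finsupp.linearCombination_apply,
      ← Finsupp.sum_curry_index c (fun k i a => a • (g ^ k * v i))]
    refine Finset.sum_congr rfl fun k _ => ?_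
    rw [Finsupp.linearCombination_apply, Finsupp.mul_sum]
    simp only [mul_smul_comm]
  rw [hsum] at hc
  suffices h : c.curry = 0 by
    have := (Finsupp.curryEquiv (α := ℕ) (β := ι) (M := K)).injective (a₁ := c) (a₂ := 0)
    apply this
    ext k i
    have := DFunLike.congr_fun (DFunLike.congr_fun h k) i
    simpa using this
  by_contra hne
  have hs : c.curry.support.Nonempty := Finsupp.support_nonempty_iff.2 hne
  obtain ⟨k₀, hk₀, hmin⟩ := c.curry.support.exists_minimal hs
  replace hmin : ∀ k ∈ c.curry.support, k₀ ≤ k := fun k hk => by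
    by_contra hlt
    exact hlt (hmin hk (by omega))
  refine (Finsupp.mem_support_iff.1 hk₀) (hv _ ?_)
  have hfac : ∑ k ∈ c.curry.support, g ^ k * Finsupp.linearCombination K v (c.curry k) =
      g ^ k₀ * ∑ k ∈ c.curry.support,
        g ^ (k - k₀) * Finsupp.linearCombination K v (c.curry k) := by
    rw [Finset.mul_sum]
    refine Finset.sum_congr rfl fun k hk => ?_
    rw [← mul_assoc, ← pow_add, Nat.add_sub_cancel' (hmin k hk)]
  rw [hfac] at hc
  have hJ'mem := hJ (hpow _ _ hc)
  rw [← Finset.add_sum_erase _ _ hk₀, Nat.sub_self, pow_zero, one_mul] at hJ'mem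
  refine (J'.add_mem_iff_left (J'.sum_mem fun k hk => ?_)).1 hJ'mem
  rw [Finset.mem_erase] at hk
  have := hmin k hk.2
  exact J'.mul_mem_right _ (J'.pow_mem_of_mem hgJ' _ (by omega))

theorem LinearIndependent.prod_pow_mul_mk {K R ι : Type*} [Field K] [CommRing R] [Algebra K R]
    (m : ℕ) (f : Fin m → R) (J : Fin (m + 1) → Ideal R) {v : ι → R} (hJ : Monotone J)
    (hfJ : ∀ i, f i ∈ J i.succ) (hf : ∀ i x, f i * x ∈ J i.castSucc → x ∈ J i.castSucc)
    (hv : LinearIndependent K (fun i => Ideal.Quotient.mk (J (Fin.last m)) (v i))) :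
    LinearIndependent K (fun p : (Fin m → ℕ) × ι =>
      Ideal.Quotient.mk (J 0) ((∏ i, f i ^ p.1 i) * v p.2)) := by
  induction m with
  | zero =>
    have := hv.comp (fun p : (Fin 0 → ℕ) × ι => p.2)
      (fun p q h => Prod.ext (Subsingleton.elim _ _) h)
    simpa [Function.comp_def] using this
  | succ m ih =>
    have h1 := ih (fun i => f i.succ) (fun i => J i.succ)
      (fun i j hij => hJ (Fin.succ_le_succ_iff.2 hij)) (fun i => hfJ i.succ)
      (fun i x hx => hf i.succ x hx) hv
    have h2 := LinearIndependent.pow_mul_mk (J := J 0) (hJ (Fin.zero_le _)) (hfJ 0) (hf 0) h1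
    have h3 := h2.comp (fun p : (Fin (m + 1) → ℕ) × ι => (p.1 0, (fun i => p.1 i.succ), p.2))
      (fun p q h => by
        simp only [Prod.mk.injEq] at h
        refine Prod.ext (funext fun i => ?_) h.2.2
        cases i using Fin.cases with
        | zero => exact h.1
        | succ i => exact congrFun h.2.1 i)
    simpa [Function.comp_def, Fin.prod_univ_succ, mul_assoc] using h3

/-- Prime avoidance for linear subspaces over an infinite field. -/
theorem Submodule.exists_mem_notMem_of_finite_primes {K R : Type*} [Field K] [Infinite K]
    [CommRing R] [Algebra K R] (W : Submodule K R) (Ps : Set (Ideal R)) (hfin : Ps.Finite)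
    (hW : ∀ P ∈ Ps, ¬ (W : Set R) ⊆ P) : ∃ w ∈ W, ∀ P ∈ Ps, w ∉ P := by
  classical
  have hne := Subspace.biUnion_ne_univ_of_top_notMem (k := K) (E := W)
    (s := hfin.toFinset.image fun P => (P.restrictScalars K).comap W.subtype) (by
      simp only [Finset.mem_image, Set.Finite.mem_toFinset, not_exists, not_and]
      intro P hP htop
      refine hW P hP fun w hw => ?_
      have : (⟨w, hw⟩ : W) ∈ (P.restrictScalars K).comap W.subtype := htop ▸ Submodule.mem_top
      simpa using this)
  obtain ⟨w, hw⟩ := (Set.ne_univ_iff_exists_notMem _).1 hne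
  refine ⟨w, w.2, fun P hP hwP => hw ?_⟩
  simp only [Set.mem_iUnion]
  exact ⟨_, Finset.mem_image_of_mem _ (hfin.mem_toFinset.2 hP), by simpa using hwP⟩

theorem Ideal.mem_radical_of_mul_mem_of_forall_minimalPrimes {R : Type*} [CommRing R]
    {I : Ideal R} {g x : R} (hg : ∀ P ∈ I.minimalPrimes, g ∉ P) (hx : g * x ∈ I.radical) :
    x ∈ I.radical := by
  rw [← Ideal.sInf_minimalPrimes, Ideal.mem_sInf] at hx ⊢
  exact fun P hP => (hP.1.1.mem_or_mem (hx hP)).resolve_left (hg P hP)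

/-- Given subspaces `W i` such that `W i` is contained in no prime of height at most `i`, there
is a sequence `f i ∈ W i` each of whose members avoids the minimal primes over its
predecessors. -/
theorem exists_seq_forall_minimalPrimes_notMem {K R : Type*} [Field K] [Infinite K]
    [CommRing R] [IsNoetherianRing R] [Algebra K R] (m : ℕ) (W : Fin m → Submodule K R)
    (hW : ∀ i : Fin m, ∀ P : Ideal R, P.IsPrime → P.height ≤ (i : ℕ) → ¬ (W i : Set R) ⊆ P) :
    ∃ f : Fin m → R, (∀ i, f i ∈ W i) ∧
      ∀ i : Fin m, ∀ P ∈ (Ideal.span (f '' Set.Iio i)).minimalPrimes, f i ∉ P := by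
  induction m with
  | zero => exact ⟨Fin.elim0, fun i => i.elim0, fun i => i.elim0⟩
  | succ m ih =>
    obtain ⟨f, hfW, hf⟩ := ih (fun i => W i.castSucc) (fun i => hW i.castSucc)
    obtain ⟨w, hw, hwP⟩ := (W (Fin.last m)).exists_mem_notMem_of_finite_primes
      (Ideal.span (Set.range f)).minimalPrimes (Ideal.finite_minimalPrimes_of_isNoetherianRing _ _)
      (fun P hP => hW _ P hP.1.1 (by
        refine (Ideal.height_le_card_of_mem_minimalPrimes_span (Set.finite_range f) hP).trans ?_
        have := Set.ncard_image_le (f := f) Set.finite_univ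
        rw [Set.image_univ, Set.ncard_univ, Nat.card_fin] at this
        exact_mod_cast this))
    refine ⟨Fin.snoc f w, fun i => ?_, fun i => ?_⟩
    · cases i using Fin.lastCases with
      | last => simpa using hw
      | cast i => simpa using hfW i
    · cases i using Fin.lastCases with
      | last =>
        have : (Fin.snoc f w : Fin (m + 1) → R) '' Set.Iio (Fin.last m) = Set.range f := by
          ext x
          constructor
          · rintro ⟨j, hj, rfl⟩
            refine ⟨j.castLT hj, ?_⟩
            conv_rhs => rw [← Fin.castSucc_castLT j hj, Fin.snoc_castSucc (α := fun _ => R)]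
          · rintro ⟨j, rfl⟩
            exact ⟨j.castSucc, Fin.castSucc_lt_last j, Fin.snoc_castSucc (α := fun _ => R) ..⟩
        simpa [this] using hwP
      | cast i =>
        have : (Fin.snoc f w : Fin (m + 1) → R) '' Set.Iio i.castSucc = f '' Set.Iio i := by
          ext x
          constructor
          · rintro ⟨j, hj, rfl⟩
            have hj' : (j : ℕ) < i := hj
            refine ⟨j.castLT (hj'.trans i.2), hj', ?_⟩
            conv_rhs => rw [← Fin.castSucc_castLT j (hj'.trans i.2),
              Fin.snoc_castSucc (α := fun _ => R)]
          · rintro ⟨j, hj, rfl⟩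
            exact ⟨j.castSucc, hj, Fin.snoc_castSucc (α := fun _ => R) ..⟩
        simpa [this] using hf i

open MvPolynomial

theorem MvPolynomial.exists_eval_ne_zero_forall_eval_eq_zero {K σ : Type*} [Field K]
    (Z : Finset (σ → K)) (z : σ → K) :
    ∃ p : MvPolynomial σ K, eval z p ≠ 0 ∧ ∀ y ∈ Z, y ≠ z → eval y p = 0 := by
  classical
  have h : ∀ y : σ → K, ∃ p : MvPolynomial σ K, y ≠ z → eval z p ≠ 0 ∧ eval y p = 0 := by
    intro y
    by_cases hy : y = z
    · exact ⟨0, fun h => absurd hy h⟩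
    · obtain ⟨i, hi⟩ := Function.ne_iff.1 hy
      exact ⟨X i - C (y i), fun _ => ⟨by simpa [sub_eq_zero] using Ne.symm hi, by simp⟩⟩
  choose p hp using h
  refine ⟨∏ y ∈ Z.erase z, p y, ?_, fun y hy hyz => ?_⟩
  · rw [map_prod, Finset.prod_ne_zero_iff]
    exact fun y hy => (hp y (Finset.ne_of_mem_erase hy)).1
  · rw [map_prod]
    exact Finset.prod_eq_zero (Finset.mem_erase.2 ⟨hyz, hy⟩) (hp y hyz).2

/-- The exponent vectors of weighted degree at most `s`. -/
def weightedExponents {n : ℕ} (d : Fin n → ℕ) (s : ℕ) : Finset (Fin n → ℕ) :=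
  (Fintype.piFinset fun _ => Finset.range (s + 1)).filter fun b => ∑ i, d i * b i ≤ s

theorem mem_weightedExponents {n : ℕ} {d : Fin n → ℕ} (hd : ∀ i, 0 < d i) {s : ℕ}
    {b : Fin n → ℕ} : b ∈ weightedExponents d s ↔ ∑ i, d i * b i ≤ s := by
  simp only [weightedExponents, Finset.mem_filter, Fintype.mem_piFinset, Finset.mem_range,
    and_iff_right_iff_imp]
  intro h i
  have h1 := Finset.single_le_sum (f := fun i => d i * b i) (fun _ _ => Nat.zero_le _)
    (Finset.mem_univ i)
  have h2 := Nat.le_mul_of_pos_left (b i) (hd i)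
  omega

theorem card_weightedExponents_one_le {n : ℕ} {d : Fin n → ℕ} (hd : ∀ i, 0 < d i) (s : ℕ) :
    (weightedExponents (fun _ : Fin n => 1) s).card ≤
      (weightedExponents d s).card * ∏ i, d i := by
  have hcard : (weightedExponents d s).card * ∏ i, d i =
      (weightedExponents d s ×ˢ Fintype.piFinset fun i => Finset.range (d i)).card := by
    simp
  rw [hcard]
  refine Finset.card_le_card_of_injOn (fun a => (fun i => a i / d i, fun i => a i % d i)) ?_ ?_
  · intro a ha
    rw [Finset.mem_coe, mem_weightedExponents (fun _ => one_pos)] at ha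
    simp only [Finset.coe_product, Set.mem_prod, Finset.mem_coe, mem_weightedExponents hd,
      Fintype.mem_piFinset, Finset.mem_range]
    refine ⟨(Finset.sum_le_sum fun i _ => ?_).trans ha, fun i => Nat.mod_lt _ (hd i)⟩
    rw [one_mul]
    exact Nat.mul_div_le _ _
  · intro a _ b _ hab
    simp only [Prod.mk.injEq] at hab
    funext i
    rw [← Nat.div_add_mod (a i) (d i), ← Nat.div_add_mod (b i) (d i), congrFun hab.1 i,
      congrFun hab.2 i]

theorem card_weightedExponents_le_pow {n : ℕ} (d : Fin n → ℕ) (s : ℕ) :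
    (weightedExponents d s).card ≤ (s + 1) ^ n := by
  refine (Finset.card_filter_le _ _).trans ?_
  simp

theorem finrank_restrictTotalDegree_le {K : Type*} [Field K] (n s : ℕ) :
    Module.finrank K (restrictTotalDegree (Fin n) K s) ≤
      (weightedExponents (fun _ : Fin n => 1) s).card := by
  rw [restrictTotalDegree, Module.finrank_eq_nat_card_basis (basisRestrictSupport K _),
    ← Nat.card_eq_finsetCard]
  refine Nat.card_le_card_of_injective (fun a => ⟨fun i => a.1 i, ?_⟩) ?_
  · rw [mem_weightedExponents (fun _ => one_pos)]
    have := a.2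
    rw [Set.mem_ofPred_eq, Finsupp.sum_fintype _ _ (fun _ => rfl)] at this
    simpa using this
  · intro a b hab
    simp only [Subtype.mk.injEq] at hab
    exact Subtype.ext (DFunLike.coe_injective hab)

theorem le_of_forall_mul_le_mul_of_le_pow {N : ℕ → ℕ} {a b e n : ℕ} (h0 : 0 < N 0)
    (h : ∀ s, a * N s ≤ b * N (s + e)) (hN : ∀ s, N s ≤ (s + 1) ^ n) : a ≤ b := by
  by_contra! hab
  have hiter : ∀ t, a ^ t * N 0 ≤ b ^ t * N (t * e) := by
    intro t
    induction t with
    | zero => simp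
    | succ t ih =>
      calc a ^ (t + 1) * N 0 = a * (a ^ t * N 0) := by ring
        _ ≤ a * (b ^ t * N (t * e)) := Nat.mul_le_mul_left _ ih
        _ = b ^ t * (a * N (t * e)) := by ring
        _ ≤ b ^ t * (b * N (t * e + e)) := Nat.mul_le_mul_left _ (h _)
        _ = b ^ (t + 1) * N ((t + 1) * e) := by rw [add_mul, one_mul]; ring
  have hb : 0 < b := by
    rcases Nat.eq_zero_or_pos b with rfl | hb
    · have := h 0
      rw [zero_mul] at this
      have := Nat.mul_pos hab h0
      omega
    · exact hb
  have hbR : (0 : ℝ) < b := by exact_mod_cast hb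
  have hr : 1 < (a : ℝ) / b := by rw [one_lt_div hbR]; exact_mod_cast hab
  have hbound : ∀ t : ℕ, ((a : ℝ) / b) ^ t ≤ ((t : ℝ) * e + 1) ^ n := by
    intro t
    rw [div_pow, div_le_iff₀ (by positivity)]
    have h1 : a ^ t ≤ b ^ t * (t * e + 1) ^ n :=
      (Nat.le_mul_of_pos_right _ h0).trans ((hiter t).trans (Nat.mul_le_mul_left _ (hN _)))
    calc (a : ℝ) ^ t ≤ b ^ t * (t * e + 1) ^ n := by exact_mod_cast h1
      _ = _ := mul_comm _ _
  have hbound' : ∀ᶠ t : ℕ in Filter.atTop,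
      (1 : ℝ) ≤ ((e : ℝ) + 1) ^ n * ((t : ℝ) ^ n / ((a : ℝ) / b) ^ t) := by
    filter_upwards [Filter.eventually_ge_atTop 1] with t ht
    rw [← mul_div_assoc, le_div_iff₀ (by positivity), one_mul, ← mul_pow]
    refine (hbound t).trans (pow_le_pow_left₀ (by positivity) ?_ n)
    have : (1 : ℝ) ≤ t := by exact_mod_cast ht
    nlinarith
  have hlim := (tendsto_pow_const_div_const_pow_of_one_lt n hr).const_mul (((e : ℝ) + 1) ^ n)
  have := ge_of_tendsto hlim hbound'
  rw [mul_zero] at this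
  linarith

/-- A Bézout-type bound. Suppose that `W i` is a space of polynomials of degree at most `d i`
vanishing on the finite set `Z ⊆ K ^ n`, and that no prime of height at most `i` contains `W i`
(`i = 0, …, n - 1`). Then `Z` has at most `∏ i, d i` elements. -/
theorem card_le_prod_of_forall_height_le {K : Type*} [Field K] [Infinite K] {n : ℕ}
    (Z : Finset (Fin n → K)) (d : Fin n → ℕ) (hd : ∀ i, 0 < d i)
    (W : Fin n → Submodule K (MvPolynomial (Fin n) K))
    (hWd : ∀ i, ∀ w ∈ W i, w.totalDegree ≤ d i) (hWZ : ∀ i, ∀ w ∈ W i, ∀ z ∈ Z, eval z w = 0)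
    (hW : ∀ i : Fin n, ∀ P : Ideal (MvPolynomial (Fin n) K), P.IsPrime → P.height ≤ (i : ℕ) →
      ¬ (W i : Set (MvPolynomial (Fin n) K)) ⊆ P) :
    Z.card ≤ ∏ i, d i := by
  classical
  obtain ⟨f, hfW, hf⟩ := exists_seq_forall_minimalPrimes_notMem n W hW
  choose p hp using fun z : Fin n → K => exists_eval_ne_zero_forall_eval_eq_zero Z z
  set J : Fin (n + 1) → Ideal (MvPolynomial (Fin n) K) :=
    fun j => (Ideal.span (f '' {i | i.castSucc < j})).radical with hJ
  have hlast : ∀ g ∈ J (Fin.last n), ∀ z ∈ Z, eval z g = 0 := by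
    rintro g ⟨k, hk⟩ z hz
    have hle : Ideal.span (f '' {i | i.castSucc < Fin.last n}) ≤ RingHom.ker (eval z) := by
      rw [Ideal.span_le]
      rintro _ ⟨i, _, rfl⟩
      exact hWZ i _ (hfW i) z hz
    have := hle hk
    rw [RingHom.mem_ker, map_pow] at this
    exact eq_zero_of_pow_eq_zero this
  have hindZ : LinearIndependent K
      (fun z : Z => Ideal.Quotient.mk (J (Fin.last n)) (p z.1)) := by
    rw [linearIndependent_mk_comp_iff]
    intro c hc
    ext z
    have h1 := hlast _ hc z.1 z.2
    rw [Finsupp.linearCombination_apply, Finsupp.sum_fintype _ _ (by simp),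
      map_sum, Finset.sum_eq_single z] at h1
    · rw [smul_eval] at h1
      exact (mul_eq_zero.1 h1).resolve_right (hp z.1).1
    · intro y _ hyz
      rw [smul_eval, (hp y.1).2 z.1 z.2 (fun h => hyz (Subtype.ext h.symm)), mul_zero]
    · exact fun h => absurd (Finset.mem_univ z) h
  have hind := LinearIndependent.prod_pow_mul_mk n f J
    (fun i j hij => Ideal.radical_mono (Ideal.span_mono (Set.image_mono
      fun k (hk : _ < i) => hk.trans_le hij)))
    (fun i => Ideal.le_radical (Ideal.subset_span ⟨i, Fin.castSucc_lt_succ, rfl⟩))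
    (fun i x hx => Ideal.mem_radical_of_mul_mem_of_forall_minimalPrimes (hf i) hx) hindZ
  have hind' : LinearIndependent K
      (fun q : (Fin n → ℕ) × Z => (∏ i, f i ^ q.1 i) * p q.2.1) :=
    LinearIndependent.of_comp (Ideal.Quotient.mkₐ K (J 0)).toLinearMap hind
  set e := Z.sup fun z => (p z).totalDegree with he
  refine le_of_forall_mul_le_mul_of_le_pow (e := e) (n := n)
    (N := fun s => (weightedExponents (fun _ : Fin n => 1) s).card) ?_ (fun s => ?_)
    (fun s => card_weightedExponents_le_pow _ s)
  · exact Finset.card_pos.2 ⟨0, (mem_weightedExponents fun _ => one_pos).2 (by simp)⟩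
  · have hmem : ∀ q : weightedExponents d s × Z,
        (∏ i, f i ^ q.1.1 i) * p q.2.1 ∈ restrictTotalDegree (Fin n) K (s + e) := by
      rintro ⟨b, z⟩
      rw [mem_restrictTotalDegree]
      refine (totalDegree_mul _ _).trans (add_le_add ?_
        (Finset.le_sup (f := fun z => (p z).totalDegree) z.2))
      refine (totalDegree_finsetProd _ _).trans
        (le_trans (Finset.sum_le_sum fun i _ => ?_) ((mem_weightedExponents hd).1 b.2))
      refine (totalDegree_pow _ _).trans ?_
      rw [mul_comm]
      exact Nat.mul_le_mul_right _ (hWd i _ (hfW i))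
    have hind'' : LinearIndependent K (fun q : weightedExponents d s × Z =>
        (⟨_, hmem q⟩ : restrictTotalDegree (Fin n) K (s + e))) := by
      refine LinearIndependent.of_comp (Submodule.subtype _) ?_
      exact hind'.comp (fun q : weightedExponents d s × Z => (q.1.1, q.2))
        (fun q r h => by
          simp only [Prod.mk.injEq] at h
          exact Prod.ext (Subtype.ext h.1) h.2)
    have hcard := hind''.fintype_card_le_finrank.trans (finrank_restrictTotalDegree_le n (s + e))
    rw [Fintype.card_prod, Fintype.card_coe, Fintype.card_coe] at hcard
    calc Z.card * (weightedExponents (fun _ : Fin n => 1) s).card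
        ≤ Z.card * ((weightedExponents d s).card * ∏ i, d i) :=
          Nat.mul_le_mul_left _ (card_weightedExponents_one_le hd s)
      _ = (∏ i, d i) * ((weightedExponents d s).card * Z.card) := by ring
      _ ≤ _ := Nat.mul_le_mul_left _ hcard

theorem MvPolynomial.height_eq_of_isMaximal {K : Type*} [Field K] [IsAlgClosed K] {n : ℕ}
    (m : Ideal (MvPolynomial (Fin n) K)) [hm : m.IsMaximal] : m.height = n := by
  have hdim : ringKrullDim (MvPolynomial (Fin n) K) = n := by simp
  have : FiniteRingKrullDim (MvPolynomial (Fin n) K) :=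
    finiteRingKrullDim_iff_ne_bot_and_top.2 (by
      rw [hdim]; exact ⟨by simp, fun h => ENat.natCast_ne_top n (WithBot.coe_injective h)⟩)
  obtain ⟨M, hM, hMh⟩ := Ideal.exists_isMaximal_height (R := MvPolynomial (Fin n) K)
  rw [hdim] at hMh
  obtain ⟨x, rfl⟩ := isMaximal_iff_eq_vanishingIdeal_singleton.1 hm
  obtain ⟨y, rfl⟩ := isMaximal_iff_eq_vanishingIdeal_singleton.1 hM
  let τ (a : Fin n → K) : MvPolynomial (Fin n) K →ₐ[K] MvPolynomial (Fin n) K :=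
    aeval fun i => X i + C (a i)
  let e : MvPolynomial (Fin n) K ≃ₐ[K] MvPolynomial (Fin n) K :=
    AlgEquiv.ofAlgHom (τ (x - y)) (τ (y - x))
      (by ext1 i; simp [τ]; ring) (by ext1 i; simp [τ]; ring)
  have hcomap : (vanishingIdeal K {y}).comap e.toRingEquiv = vanishingIdeal K {x} := by
    ext p
    have : aeval y (e p) = aeval x p := by
      change ((aeval y).comp (τ (x - y))) p = aeval x p
      congr 1
      ext i
      simp [τ]
    simp only [Ideal.mem_comap, mem_vanishingIdeal_singleton_iff, ← this]
    rfl
  have := e.toRingEquiv.height_comap (vanishingIdeal K {y})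
  rw [hcomap] at this
  rw [this]
  exact_mod_cast hMh

/-- In `K[x₁, …, xₙ]`, with `K` algebraically closed, a prime of height at most `j` is contained
in the members of a chain of primes of length at least `n - j`. -/
theorem MvPolynomial.exists_ltSeries_of_height_le {K : Type*} [Field K] [IsAlgClosed K] {n j : ℕ}
    (P : Ideal (MvPolynomial (Fin n) K)) [hP : P.IsPrime] (hj : P.height ≤ j) :
    ∃ l : LTSeries (PrimeSpectrum (MvPolynomial (Fin n) K)),
      n ≤ l.length + j ∧ ∀ i, P ≤ (l i).asIdeal := by
  obtain ⟨s, hPs, hs⟩ := Ideal.exists_finset_card_eq_height_of_isNoetherianRing P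
  set I := Ideal.span (s : Set (MvPolynomial (Fin n) K)) with hI
  obtain ⟨a, ha, haP⟩ : ∃ a, (∀ Q ∈ I.minimalPrimes, Q ≠ P → a ∈ Q) ∧ a ∉ P := by
    by_contra! h
    have hfin := (Ideal.finite_minimalPrimes_of_isNoetherianRing _ I).subset
      (Set.sdiff_subset (t := {P}))
    have hle : hfin.toFinset.inf id ≤ P := fun a ha => h a fun Q hQ hQP =>
      (Finset.inf_le (f := id) (hfin.mem_toFinset.2 ⟨hQ, hQP⟩) : _ ≤ Q) ha
    obtain ⟨Q, hQ, hQP⟩ := (Ideal.IsPrime.inf_le' hP).1 hle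
    obtain ⟨hQ, hne⟩ := hfin.mem_toFinset.1 hQ
    exact hne (le_antisymm hQP (hPs.2 hQ.1 hQP))
  obtain ⟨m, hm, hPm, ham⟩ : ∃ m : Ideal (MvPolynomial (Fin n) K), m.IsMaximal ∧ P ≤ m ∧ a ∉ m := by
    have : a ∉ P.jacobson := by rwa [← P.radical_eq_jacobson, hP.radical]
    rw [Ideal.jacobson, Ideal.mem_sInf] at this
    push Not at this
    obtain ⟨m, ⟨h1, h2⟩, h3⟩ := this
    exact ⟨m, h2, h1, h3⟩
  have hIm : I ≤ m := hPs.1.2.trans hPm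
  have : (m.map (Ideal.Quotient.mk I)).IsPrime := Ideal.isPrime_map_quotientMk_of_isPrime hIm
  obtain ⟨l, hlast, hlen⟩ := (m.map (Ideal.Quotient.mk I)).exists_ltSeries_length_eq_height
  have hmono : StrictMono (PrimeSpectrum.comap (Ideal.Quotient.mk I)) :=
    Monotone.strictMono_of_injective (fun _ _ h => Ideal.comap_mono h)
      (PrimeSpectrum.comap_injective_of_surjective _ Ideal.Quotient.mk_surjective)
  refine ⟨l.map _ hmono, ?_, fun i => ?_⟩
  · have h1 := Ideal.height_le_height_add_encard_of_subset (s : Set (MvPolynomial (Fin n) K))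
      (Ideal.span_le.1 hIm)
    rw [MvPolynomial.height_eq_of_isMaximal, ← hlen, Set.encard_coe_eq_coe_finsetCard] at h1
    have h2 : n ≤ l.length + s.card := by exact_mod_cast h1
    have h3 : s.card ≤ j := by rw [← hs] at hj; exact_mod_cast hj
    exact h2.trans (Nat.add_le_add_left h3 _)
  · change P ≤ (l i).asIdeal.comap (Ideal.Quotient.mk I)
    have hIQ : I ≤ (l i).asIdeal.comap (Ideal.Quotient.mk I) := by
      intro x hx
      rw [Ideal.mem_comap, Ideal.Quotient.eq_zero_iff_mem.2 hx]
      exact zero_mem _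
    have hQm : (l i).asIdeal.comap (Ideal.Quotient.mk I) ≤ m := by
      have h1 : (l i).asIdeal ≤ m.map (Ideal.Quotient.mk I) := by
        have h2 : l i ≤ l.last := l.monotone (Fin.le_last i)
        rw [hlast] at h2
        exact h2
      refine (Ideal.comap_mono h1).trans ?_
      rw [Ideal.comap_map_of_surjective' _ Ideal.Quotient.mk_surjective, Ideal.mk_ker]
      exact sup_le le_rfl hIm
    obtain ⟨P', hP', hP'Q⟩ := Ideal.exists_minimalPrimes_le hIQ
    by_cases hPP' : P' = P
    · exact hPP' ▸ hP'Q
    · exact absurd (hQm (hP'Q (ha P' hP' hPP'))) ham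

theorem MvPolynomial.isPrime_vanishingIdeal {K : Type*} [Field K] {n : ℕ} {W : Set (Fin n → K)}
    (hW : IsIrreducibleSubvariety W) : (vanishingIdeal K W).IsPrime := by
  obtain ⟨-, ⟨x, hx⟩, hirr⟩ := hW
  refine ⟨fun htop => ?_, fun {p q} hpq => ?_⟩
  · have : (1 : MvPolynomial (Fin n) K) ∈ vanishingIdeal K W := htop ▸ Submodule.mem_top
    simpa using this x hx
  · have := hirr {x | ∀ r ∈ ({p} : Set (MvPolynomial (Fin n) K)), eval x r = 0}
      {x | ∀ r ∈ ({q} : Set (MvPolynomial (Fin n) K)), eval x r = 0} ⟨_, rfl⟩ ⟨_, rfl⟩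
      (fun y hy => by
        have := hpq y hy
        simpa [aeval_eq_eval] using this)
    refine this.imp (fun h y hy => ?_) (fun h y hy => ?_)
    all_goals simpa [aeval_eq_eval] using h hy

theorem IsSubvariety.zeroLocus_vanishingIdeal {K : Type*} [Field K] {n : ℕ}
    {W : Set (Fin n → K)} (hW : IsSubvariety W) : zeroLocus K (vanishingIdeal K W) = W := by
  obtain ⟨S, rfl⟩ := hW
  refine subset_antisymm (fun x hx p hp => ?_) (zeroLocus_vanishingIdeal_le _)
  rw [← aeval_eq_eval]
  exact hx p fun y hy => by simpa [aeval_eq_eval] using hy p hp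

theorem isIrreducibleSubvariety_zeroLocus {K : Type*} [Field K] [IsAlgClosed K] {n : ℕ}
    (Q : Ideal (MvPolynomial (Fin n) K)) [hQ : Q.IsPrime] :
    IsIrreducibleSubvariety (zeroLocus K Q) := by
  refine ⟨⟨Q, by ext; simp [aeval_eq_eval]⟩, ?_, ?_⟩
  · by_contra hne
    rw [Set.not_nonempty_iff_eq_empty] at hne
    have := IsPrime.vanishingIdeal_zeroLocus Q (K := K)
    rw [hne, vanishingIdeal_empty] at this
    exact hQ.ne_top this.symm
  · rintro _ _ ⟨S₁, rfl⟩ ⟨S₂, rfl⟩ hsub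
    by_contra! h
    obtain ⟨h1, h2⟩ := h
    simp only [Set.not_subset, Set.mem_ofPred_eq, not_forall] at h1 h2
    obtain ⟨x, hx, p, hp, hpx⟩ := h1
    obtain ⟨y, hy, q, hq, hqy⟩ := h2
    have hpq : p * q ∈ vanishingIdeal K (zeroLocus K Q) := by
      intro z hz
      rcases hsub hz with h | h
      · simp [aeval_eq_eval, h p hp]
      · simp [aeval_eq_eval, h q hq]
    rw [IsPrime.vanishingIdeal_zeroLocus] at hpq
    rcases hQ.mem_or_mem hpq with h | h
    · exact hpx (by simpa [aeval_eq_eval] using hx p h)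
    · exact hqy (by simpa [aeval_eq_eval] using hy q h)

theorem length_le_of_strictMono_isIrreducibleSubvariety {K : Type*} [Field K] {n k : ℕ}
    {C : Fin (k + 1) → Set (Fin n → K)} (hC : ∀ i, IsIrreducibleSubvariety (C i))
    (hmono : StrictMono C) : k ≤ n := by
  let l : LTSeries (PrimeSpectrum (MvPolynomial (Fin n) K)) :=
    { length := k
      toFun := fun i => ⟨vanishingIdeal K (C i.rev), isPrime_vanishingIdeal (hC _)⟩
      step := fun i => by
        have hlt : C i.succ.rev < C i.castSucc.rev :=
          hmono (Fin.rev_lt_rev.2 Fin.castSucc_lt_succ)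
        refine ⟨vanishingIdeal_anti_mono hlt.le, fun h => hlt.not_ge ?_⟩
        rw [← (hC i.succ.rev).1.zeroLocus_vanishingIdeal,
          ← (hC i.castSucc.rev).1.zeroLocus_vanishingIdeal]
        exact zeroLocus_anti_mono h }
  have h1 : (l.length : WithBot ℕ∞) ≤ ringKrullDim (MvPolynomial (Fin n) K) :=
    Order.LTSeries.length_le_krullDim l
  have h2 : ringKrullDim (MvPolynomial (Fin n) K) = n := by simp
  rw [h2] at h1
  exact_mod_cast h1

theorem LTSeries.length_le_varDim {K : Type*} [Field K] [IsAlgClosed K] {n : ℕ}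
    {V : Set (Fin n → K)} (l : LTSeries (PrimeSpectrum (MvPolynomial (Fin n) K)))
    (hl : ∀ i, zeroLocus K (l i).asIdeal ⊆ V) : l.length ≤ varDim V := by
  refine le_csSup ⟨n, ?_⟩ ⟨fun i => zeroLocus K (l i.rev).asIdeal,
    fun i => isIrreducibleSubvariety_zeroLocus _, fun i => hl _, fun i j hij => ?_⟩
  · rintro k ⟨C, hC, -, hmono⟩
    exact length_le_of_strictMono_isIrreducibleSubvariety hC hmono
  · have hlt : l j.rev < l i.rev := l.strictMono (Fin.rev_lt_rev.2 hij)
    refine lt_of_le_of_ne (zeroLocus_anti_mono hlt.le) fun h => hlt.ne' (PrimeSpectrum.ext ?_)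
    have h' : zeroLocus K (l i.rev).asIdeal = zeroLocus K (l j.rev).asIdeal := h
    rw [← IsPrime.vanishingIdeal_zeroLocus (K := K) (l i.rev).asIdeal,
      ← IsPrime.vanishingIdeal_zeroLocus (K := K) (l j.rev).asIdeal, h']

theorem MvPolynomial.le_varDim_add_of_height_le {K : Type*} [Field K] [IsAlgClosed K] {n j : ℕ}
    {V : Set (Fin n → K)} (P : Ideal (MvPolynomial (Fin n) K)) [P.IsPrime]
    (hPV : zeroLocus K P ⊆ V) (hj : P.height ≤ j) : n ≤ varDim V + j := by
  obtain ⟨l, hl, hPl⟩ := exists_ltSeries_of_height_le P hj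
  exact hl.trans (Nat.add_le_add_right
    (l.length_le_varDim fun i => (zeroLocus_anti_mono (hPl i)).trans hPV) _)

theorem FiniteField.prod_X_sub_C_eq (F : Type*) [Field F] [Fintype F] :
    ∏ a : F, (Polynomial.X - Polynomial.C a) = Polynomial.X ^ Fintype.card F - Polynomial.X := by
  have hmonic : (Polynomial.X ^ Fintype.card F - Polynomial.X : Polynomial F).Monic :=
    Polynomial.monic_X_pow_sub (by
      rw [Polynomial.degree_X]; exact_mod_cast Fintype.one_lt_card)
  have h := Polynomial.prod_multiset_X_sub_C_of_monic_of_roots_card_eq hmonic (by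
    rw [roots_X_pow_card_sub_X, X_pow_card_sub_X_natDegree_eq F Fintype.one_lt_card]; rfl)
  rwa [roots_X_pow_card_sub_X] at h

theorem MvPolynomial.height_eq_of_forall_X_pow_card_sub_X_mem {F K : Type*} [Field F] [Fintype F]
    [Field K] [IsAlgClosed K] (f : F →+* K) {n : ℕ} (P : Ideal (MvPolynomial (Fin n) K))
    [hP : P.IsPrime] (h : ∀ i, (X i ^ Fintype.card F - X i : MvPolynomial (Fin n) K) ∈ P) :
    P.height = n := by
  have hroot (i : Fin n) : ∃ a : F, (X i - C (f a) : MvPolynomial (Fin n) K) ∈ P := by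
    have h1 : (X i ^ Fintype.card F - X i : MvPolynomial (Fin n) K) = ∏ a : F, (X i - C (f a)) := by
      have h2 := congrArg (Polynomial.eval₂ (C.comp f) (X i : MvPolynomial (Fin n) K))
        (FiniteField.prod_X_sub_C_eq F).symm
      simpa [Polynomial.eval₂_finsetProd] using h2
    have h3 := h i
    rw [h1, hP.prod_mem_iff] at h3
    simpa using h3
  choose a ha using hroot
  have hle : vanishingIdeal K {fun i => f (a i)} ≤ P := by
    intro p hp
    have h1 : Ideal.Quotient.mk P p = Ideal.Quotient.mk P (C (eval (fun i => f (a i)) p)) := by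
      have h2 : (Ideal.Quotient.mk P) = ((Ideal.Quotient.mk P).comp C).comp
          (eval fun i => f (a i)) := by
        ext i
        · simp
        · simpa using Ideal.Quotient.eq.2 (ha i)
      exact RingHom.congr_fun h2 p
    rw [← Ideal.Quotient.eq_zero_iff_mem, h1]
    have h2 : eval (fun i => f (a i)) p = 0 := by simpa [aeval_eq_eval] using hp
    simp [h2]
  have hmax : (vanishingIdeal K {fun i => f (a i)}).IsMaximal :=
    isMaximal_iff_eq_vanishingIdeal_singleton.2 ⟨_, rfl⟩
  rw [← hmax.eq_of_le hP.ne_top hle]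
  exact height_eq_of_isMaximal _

/-- The number of points over a finite field of a variety of codimension `c` cut out by polynomials
of degree at most `D` is at most `D ^ c * q ^ (n - c)`. -/
theorem card_le_pow_mul_pow_of_forall_mem {F K : Type*} [Field F] [Fintype F]
    [Field K] [IsAlgClosed K] (f : F →+* K) {n D : ℕ} (hD : 0 < D)
    (S : Set (MvPolynomial (Fin n) K)) (hS : ∀ p ∈ S, p.totalDegree ≤ D)
    {V : Set (Fin n → K)} (hV : V = {x | ∀ p ∈ S, eval x p = 0})
    (Z : Finset (Fin n → F)) (hZ : ∀ z ∈ Z, f ∘ z ∈ V) :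
    Z.card ≤ D ^ (n - varDim V) * Fintype.card F ^ (n - (n - varDim V)) := by
  classical
  have : Infinite K := IsAlgClosed.instInfinite
  set c := n - varDim V with hc
  let R : Set (MvPolynomial (Fin n) K) := Set.range fun i => X i ^ Fintype.card F - X i
  let d (i : Fin n) : ℕ := if (i : ℕ) < c then D else Fintype.card F
  let G (i : Fin n) : Set (MvPolynomial (Fin n) K) := if (i : ℕ) < c then S else R
  have hRd : ∀ p ∈ R, p.totalDegree ≤ Fintype.card F := by
    rintro _ ⟨i, rfl⟩
    refine (totalDegree_sub _ _).trans (max_le ?_ ?_)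
    · simp
    · simpa using Nat.one_le_iff_ne_zero.2 Fintype.card_ne_zero
  have hprod : ∏ i, d i = D ^ c * Fintype.card F ^ (n - c) := by
    have h1 := Finset.card_filter_add_card_filter_not (s := (Finset.univ : Finset (Fin n)))
      (fun i : Fin n => (i : ℕ) < c)
    have h2 : (Finset.univ.filter fun i : Fin n => (i : ℕ) < c).card = c := by
      rw [Fin.card_filter_val_lt]; omega
    rw [h2, Finset.card_univ, Fintype.card_fin] at h1
    rw [Finset.prod_ite, Finset.prod_const, Finset.prod_const, h2]
    congr 2
    omega
  have hinj : Function.Injective fun z : Fin n → F => f ∘ z := f.injective.comp_left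
  rw [← hprod, ← Finset.card_image_of_injective Z hinj]
  refine card_le_prod_of_forall_height_le _ d (fun i => ?_) (fun i => Submodule.span K (G i))
    (fun i w hw => ?_) (fun i w hw z hz => ?_) (fun i P hP hPh hWP => ?_)
  · dsimp only [d]
    split_ifs
    exacts [hD, Fintype.card_pos]
  · rw [← mem_restrictTotalDegree]
    refine Submodule.span_le.2 (fun p hp => ?_) hw
    rw [SetLike.mem_coe, mem_restrictTotalDegree]
    dsimp only [d]
    dsimp only [G] at hp
    split_ifs at hp ⊢
    exacts [hS p hp, hRd p hp]
  · obtain ⟨z, hzZ, rfl⟩ := Finset.mem_image.1 hz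
    have hle : Submodule.span K (G i) ≤ LinearMap.ker (aeval (R := K) (f ∘ z)).toLinearMap := by
      refine Submodule.span_le.2 fun p hp => ?_
      change aeval (f ∘ z) p = 0
      dsimp only [G] at hp
      split_ifs at hp
      · have := hZ z hzZ
        rw [hV] at this
        simpa [aeval_eq_eval] using this p hp
      · obtain ⟨j, rfl⟩ := hp
        simp [aeval_eq_eval, ← map_pow f, FiniteField.pow_card, eval_pow]
    simpa [aeval_eq_eval] using hle hw
  · have hGP : G i ⊆ P := Submodule.subset_span.trans hWP
    dsimp only [G] at hGP
    split_ifs at hGP with hi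
    · have := le_varDim_add_of_height_le (V := V) P (fun x hx => by
        rw [hV]
        intro p hp
        simpa [aeval_eq_eval] using hx p (hGP hp)) hPh
      omega
    · rw [height_eq_of_forall_X_pow_card_sub_X_mem f P fun j => hGP ⟨j, rfl⟩] at hPh
      have : n ≤ i := by exact_mod_cast hPh
      omega

theorem AddChar.sum_apply_dotProduct {F : Type*} [Field F] [Fintype F] [DecidableEq F]
    {χ : AddChar F ℂ} (hχ : χ ≠ 1) {ι : Type*} [Fintype ι] [DecidableEq ι] (s : ι → F) :
    ∑ z : ι → F, χ (∑ k, z k * s k) = if s = 0 then (Fintype.card F : ℂ) ^ Fintype.card ι else 0 := by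
  have hsum (a : ι → F) : χ (∑ k, a k) = ∏ k, χ (a k) :=
    map_prod χ.toMonoidHom (fun k => Multiplicative.ofAdd (a k)) Finset.univ
  simp_rw [hsum]
  rw [← Fintype.piFinset_univ, ← Finset.prod_univ_sum (fun _ => Finset.univ)
    fun k z => χ (z * s k)]
  simp_rw [AddChar.sum_mulShift _ (AddChar.IsPrimitive.of_ne_one hχ)]
  split_ifs with h
  · simp [h]
  · obtain ⟨k, hk⟩ := Function.ne_iff.1 h
    exact Finset.prod_eq_zero (Finset.mem_univ k) (by simpa using hk)

theorem sum_addChar_eq_card_mul {F : Type*} [Field F] [Fintype F] [DecidableEq F]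
    {χ : AddChar F ℂ} (hχ : χ ≠ 1) {n₁ n₂ n₃ : ℕ} (M : Fin n₁ → Fin n₂ → Fin n₃ → F) :
    ∑ x : (Fin n₁ → F) × (Fin n₂ → F) × (Fin n₃ → F),
      χ (∑ i, ∑ j, ∑ k, M i j k * x.1 i * x.2.1 j * x.2.2 k) =
    ((Finset.univ.filter fun x : Fin (n₁ + n₂) → F => ∀ k,
      ∑ i, ∑ j, M i j k * x (Fin.castAdd n₂ i) * x (Fin.natAdd n₁ j) = 0).card : ℂ) *
      (Fintype.card F : ℂ) ^ n₃ := by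
  have hx (x : (Fin n₁ → F) × (Fin n₂ → F) × (Fin n₃ → F)) :
      ∑ i, ∑ j, ∑ k, M i j k * x.1 i * x.2.1 j * x.2.2 k =
      ∑ k, x.2.2 k * ∑ i, ∑ j, M i j k * x.1 i * x.2.1 j := by
    simp_rw [Finset.mul_sum, Finset.sum_comm (s := (Finset.univ : Finset (Fin n₃)))]
    simp_rw [mul_comm]
  simp_rw [hx, Fintype.sum_prod_type]
  simp_rw [AddChar.sum_apply_dotProduct hχ fun k => ∑ i, ∑ j, M i j k * _ * _]
  rw [← Fintype.sum_prod_type', ← (Fin.appendEquiv n₁ n₂).symm.sum_comp]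
  rw [Finset.card_filter, Nat.cast_sum, Finset.sum_mul]
  refine Finset.sum_congr rfl fun x _ => ?_
  simp [funext_iff, Fin.appendEquiv]

theorem mul_le_neg_logb_of_le_pow_mul_pow {q N n c : ℕ} (hq : 1 < q) (hN : 0 < N) (hc : c ≤ n)
    (h : N ≤ 2 ^ c * q ^ (n - c)) :
    (1 - Real.logb q 2) * c ≤ -Real.logb q (N / (q : ℝ) ^ n) := by
  have hq' : (1 : ℝ) < q := by exact_mod_cast hq
  have hN' : (0 : ℝ) < N := by exact_mod_cast hN
  have hlog : Real.logb q q = 1 := Real.logb_self_eq_one hq'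
  have h1 : Real.logb q N ≤ c * Real.logb q 2 + (n - c) := by
    have h2 : Real.logb q N ≤ Real.logb q (2 ^ c * (q : ℝ) ^ (n - c)) :=
      Real.logb_le_logb_of_le hq' hN' (by exact_mod_cast h)
    rwa [Real.logb_mul (by positivity) (by positivity), Real.logb_pow, Real.logb_pow, hlog,
      Nat.cast_sub hc, mul_one] at h2
  rw [Real.logb_div hN'.ne' (by positivity), Real.logb_pow, hlog]
  linarith

/-- The number of common zeros over `F` of the slices of a 3-tensor, in terms of the codimension of
their common zero set over an algebraically closed field. -/
theorem card_common_zeros_slices_le {F K : Type*} [Field F] [Fintype F] [DecidableEq F]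
    [Field K] [IsAlgClosed K] (f : F →+* K) {n₁ n₂ n₃ : ℕ} (M : Fin n₁ → Fin n₂ → Fin n₃ → F)
    {V : Set (Fin (n₁ + n₂) → K)}
    (hV : V = {x | ∀ z : Fin n₃ → K, ∑ i, ∑ j, ∑ k,
      f (M i j k) * x (Fin.castAdd n₂ i) * x (Fin.natAdd n₁ j) * z k = 0}) :
    (Finset.univ.filter fun x : Fin (n₁ + n₂) → F => ∀ k,
      ∑ i, ∑ j, M i j k * x (Fin.castAdd n₂ i) * x (Fin.natAdd n₁ j) = 0).card ≤
    2 ^ (n₁ + n₂ - varDim V) * Fintype.card F ^ (n₁ + n₂ - (n₁ + n₂ - varDim V)) := by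
  let S (k : Fin n₃) : MvPolynomial (Fin (n₁ + n₂)) K :=
    ∑ i, ∑ j, C (f (M i j k)) * X (Fin.castAdd n₂ i) * X (Fin.natAdd n₁ j)
  have heval (x : Fin (n₁ + n₂) → K) (k : Fin n₃) : eval x (S k) =
      ∑ i, ∑ j, f (M i j k) * x (Fin.castAdd n₂ i) * x (Fin.natAdd n₁ j) := by
    simp [S]
  have hV' : V = {x | ∀ p ∈ Set.range S, eval x p = 0} := by
    have hsum (x : Fin (n₁ + n₂) → K) (z : Fin n₃ → K) : ∑ i, ∑ j, ∑ k,
        f (M i j k) * x (Fin.castAdd n₂ i) * x (Fin.natAdd n₁ j) * z k =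
        ∑ k, eval x (S k) * z k := by
      simp_rw [heval, Finset.sum_mul, Finset.sum_comm (s := (Finset.univ : Finset (Fin n₃)))]
    rw [hV]
    ext x
    simp_rw [hsum, Set.mem_ofPred_eq, Set.forall_mem_range]
    refine ⟨fun h k => ?_, fun h z => by simp [h]⟩
    classical
    simpa [Pi.single_apply] using h (Pi.single k 1)
  refine card_le_pow_mul_pow_of_forall_mem f two_pos (Set.range S) ?_ hV' _ fun x hx => ?_
  · rintro _ ⟨k, rfl⟩
    refine totalDegree_finsetSum_le fun i _ => totalDegree_finsetSum_le fun j _ => ?_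
    refine (totalDegree_mul _ _).trans ?_
    have h := totalDegree_mul (C (f (M i j k))) (X (Fin.castAdd n₂ i))
    simp only [totalDegree_X, totalDegree_C] at h ⊢
    omega
  · rw [hV']
    rintro _ ⟨k, rfl⟩
    rw [heval]
    have := congrArg f ((Finset.mem_filter.1 hx).2 k)
    simpa using this

end

/-- Cohen–Moshkovitz: for any 3-tensor `T` over a finite field `F` (given by its coefficient
array `M`), `AR(T) ≥ (1 - log_{|F|} 2) · GR(T)`, where `GR(T)` is the codimension over the
algebraic closure of the variety `{(x₁,x₂) : T(x₁,x₂,·) ≡ 0}`. -/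
theorem analyticRank_ge_geometricRank (F : Type*) [Field F] [Fintype F]
    (χ : AddChar F ℂ) (hχ : χ ≠ 1) (n₁ n₂ n₃ : ℕ)
    (M : Fin n₁ → Fin n₂ → Fin n₃ → F)
    (V : Set (Fin (n₁ + n₂) → AlgebraicClosure F))
    (hV : V = {x | ∀ z : Fin n₃ → AlgebraicClosure F,
      ∑ i : Fin n₁, ∑ j : Fin n₂, ∑ k : Fin n₃,
        algebraMap F (AlgebraicClosure F) (M i j k) *
          x (Fin.castAdd n₂ i) * x (Fin.natAdd n₁ j) * z k = 0}) :
    - Real.logb (Fintype.card F)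
        ((((∑ x : (Fin n₁ → F) × (Fin n₂ → F) × (Fin n₃ → F),
            χ (∑ i : Fin n₁, ∑ j : Fin n₂, ∑ k : Fin n₃,
              M i j k * x.1 i * x.2.1 j * x.2.2 k)) /
          (Fintype.card ((Fin n₁ → F) × (Fin n₂ → F) × (Fin n₃ → F)) : ℂ)).re)) ≥
      (1 - Real.logb (Fintype.card F) 2) * ((n₁ + n₂ - varDim V : ℕ) : ℝ) := by
  classical
  have hq : 1 < Fintype.card F := Fintype.one_lt_card
  set Z := Finset.univ.filter fun x : Fin (n₁ + n₂) → F => ∀ k,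
    ∑ i, ∑ j, M i j k * x (Fin.castAdd n₂ i) * x (Fin.natAdd n₁ j) = 0 with hZ
  have hpos : 0 < Z.card := Finset.card_pos.2 ⟨0, by simp [hZ]⟩
  have hbias : ((∑ x : (Fin n₁ → F) × (Fin n₂ → F) × (Fin n₃ → F),
      χ (∑ i : Fin n₁, ∑ j : Fin n₂, ∑ k : Fin n₃, M i j k * x.1 i * x.2.1 j * x.2.2 k)) /
      (Fintype.card ((Fin n₁ → F) × (Fin n₂ → F) × (Fin n₃ → F)) : ℂ)).re =
      Z.card / (Fintype.card F : ℝ) ^ (n₁ + n₂) := by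
    rw [sum_addChar_eq_card_mul hχ, ← hZ]
    have h0 : (Fintype.card F : ℂ) ≠ 0 := Nat.cast_ne_zero.2 Fintype.card_ne_zero
    have : (Z.card : ℂ) * (Fintype.card F : ℂ) ^ n₃ /
        (Fintype.card ((Fin n₁ → F) × (Fin n₂ → F) × (Fin n₃ → F)) : ℂ) =
        ((Z.card / (Fintype.card F : ℝ) ^ (n₁ + n₂) : ℝ) : ℂ) := by
      simp only [Fintype.card_prod, Fintype.card_fun, Fintype.card_fin]
      push_cast
      rw [pow_add]
      field_simp
    rw [this, Complex.ofReal_re]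
  rw [hbias]
  exact mul_le_neg_logb_of_le_pow_mul_pow hq hpos (Nat.sub_le _ _)
    (card_common_zeros_slices_le (algebraMap F (AlgebraicClosure F)) M hV)
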